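/- Let A be a unital Banach *-algebra with continuous involution and identity of norm one. If every continuous linear functional ω on A satisfying ‖ω‖ = ω(1) is positive (i.e., ω(a* a) ≥ 0 for all a ∈ A), then A, with its given norm and involution, is a C*-algebra. -/

import Mathlib

open scoped ComplexOrder

/-- In a unital C⋆-algebra, `1 + y` with `‖y‖ < 1` is the sum of two unitaries which are products of
exponentials. -/
theorem CStarAlgebra.exists_one_add_eq_expUnitary_mul {B : Type*} [CStarAlgebra B] {y : B}
    (hy : ‖y‖ < 1) : ∃ g k : selfAdjoint B, 1 + y = (selfAdjoint.expUnitary g : B) *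
      ((selfAdjoint.expUnitary k : B) + (star (selfAdjoint.expUnitary k) : unitary B)) := by
  let _ := CStarAlgebra.spectralOrder B
  let _ := CStarAlgebra.spectralOrderedRing B
  nontriviality B
  have hV : IsUnit (1 + y) := by
    have h := (Units.oneSub (-y) (by simpa using hy)).isUnit
    rwa [Units.val_oneSub, sub_neg_eq_add] at h
  set V := 1 + y with hVdef
  set q := CFC.abs V with hq
  have hqq : q * q = star V * V := CFC.abs_mul_abs V
  have hq0 : 0 ≤ q := CFC.abs_nonneg V
  have hqu : IsUnit q := by
    have : IsUnit (q * q) := hqq ▸ hV.star.mul hV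
    exact ((Commute.refl q).isUnit_mul_iff.mp this).1
  have hqn : ‖q‖ ≤ 2 := by
    have : ‖q‖ * ‖q‖ = ‖V‖ * ‖V‖ := by
      rw [← CStarRing.norm_star_mul_self, hq0.isSelfAdjoint.star_eq, hqq,
        CStarRing.norm_star_mul_self]
    have h2 : ‖V‖ ≤ 2 := (norm_add_le _ _).trans (by rw [norm_one]; linarith)
    nlinarith [norm_nonneg q, norm_nonneg V]
  let c : selfAdjoint B := ⟨(2⁻¹ : ℝ) • q, (IsSelfAdjoint.all (2⁻¹ : ℝ)).smul hq0.isSelfAdjoint⟩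
  have hc0 : (0 : B) ≤ c := smul_nonneg (by norm_num) hq0
  have hcn : ‖(c : B)‖ ≤ 1 := by
    change ‖(2⁻¹ : ℝ) • q‖ ≤ 1
    rw [norm_smul]; norm_num; linarith
  have hcq : (2 : ℝ) • (c : B) = q := by simp [c]
  have h1c : ‖1 - (c : B)‖ ≤ 1 := by
    have := (CStarAlgebra.norm_le_one_iff_of_nonneg (c : B) hc0).mp hcn
    rw [CStarAlgebra.norm_le_one_iff_of_nonneg _ (sub_nonneg.mpr this)]
    exact sub_le_self _ hc0
  have h2q : ‖(2 : B) - q‖ ≤ 2 := by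
    have : (2 : B) - q = (2 : ℝ) • (1 - (c : B)) := by
      rw [smul_sub, hcq, ← Algebra.algebraMap_eq_smul_one, map_ofNat]
    rw [this, norm_smul]; norm_num; linarith
  obtain ⟨p, hp⟩ := hqu
  have hps : star (↑p⁻¹ : B) = ↑p⁻¹ := by
    rw [← Units.coe_star_inv, inv_inj.mpr]
    ext
    simp [hp, hq0.isSelfAdjoint.star_eq]
  let W : B := V * ↑p⁻¹
  have hW : W ∈ unitary B := by
    have h1 : star W * W = 1 := by
      simp only [W, star_mul, hps]
      rw [mul_assoc, ← mul_assoc (star V), ← hqq, ← hp]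
      simp
    obtain ⟨w, hw⟩ : IsUnit W := hV.mul p⁻¹.isUnit
    refine Unitary.mem_iff.mpr ⟨h1, ?_⟩
    rw [← hw] at h1 ⊢
    rw [← w.inv_eq_of_mul_eq_one_left h1]
    simp
  have hWV : W * q = V := by simp [W, ← hp]
  have hW2 : ‖W - 1‖ < 2 := by
    rw [Unitary.norm_sub_one_lt_two_iff hW, spectrum.notMem_iff]
    have h3 : IsUnit (q + V) := by
      have h4 : ‖(1 : B) - (3⁻¹ : ℝ) • (q + V)‖ < 1 := by
        have : (1 : B) - (3⁻¹ : ℝ) • (q + V) = (3⁻¹ : ℝ) • ((2 - q) - y) := by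
          have : (1 : B) = (3⁻¹ : ℝ) • (3 : B) := by
            rw [← map_ofNat (algebraMap ℝ B), Algebra.algebraMap_eq_smul_one, smul_smul]; norm_num
          nth_rw 1 [this]
          rw [← smul_sub, hVdef]
          congr 1
          rw [show (3 : B) = 2 + 1 by norm_num]
          abel
        rw [this, norm_smul]
        have := norm_sub_le ((2 : B) - q) y
        norm_num
        linarith
      have h5 := (Units.oneSub _ h4).isUnit
      simp only [Units.val_oneSub, sub_sub_cancel] at h5
      have h6 := h5.smul (Units.mk0 (3 : ℝ) (by norm_num))
      simpa [Units.smul_def, smul_smul, -smul_add] using h6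
    have h4 : (algebraMap ℂ B (-1) - W) * q = -(q + V) := by
      simp [sub_mul, hWV]; abel
    have h5 : IsUnit ((algebraMap ℂ B (-1) - W) * q) := h4 ▸ h3.neg
    rw [← hp] at h5
    simpa using h5
  have hcn' : ‖c‖ ≤ 1 := hcn
  set z := selfAdjoint.unitarySelfAddISMul c hcn' with hz
  have hzz : (z : B) + (star z : unitary B) = q := by
    rw [Unitary.coe_star, hz, selfAdjoint.star_coe_unitarySelfAddISMul,
      selfAdjoint.unitarySelfAddISMul_coe, ← hcq, two_smul]
    abel
  have hz2 : ‖(z : B) - 1‖ < 2 := by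
    have : star ((z : B) - 1) * ((z : B) - 1) = 2 - q := by
      rw [← hzz, star_sub, star_one, sub_mul, mul_sub, Unitary.coe_star_mul_self,
        Unitary.coe_star, ← one_add_one_eq_two]
      simp only [one_mul, mul_one]
      abel
    have h3 := CStarRing.norm_star_mul_self (x := (z : B) - 1)
    rw [this] at h3
    nlinarith [norm_nonneg ((z : B) - 1)]
  refine ⟨Unitary.argSelfAdjoint ⟨W, hW⟩, Unitary.argSelfAdjoint z, ?_⟩
  rw [expUnitary_argSelfAdjoint hz2, expUnitary_argSelfAdjoint hW2, hzz, hWV]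

/-- A submultiplicative norm on a unital C⋆-algebra which is at most one on the exponentials of
skew-adjoint elements is dominated by the C⋆-norm. -/
theorem CStarAlgebra.norm_map_le_of_norm_map_exp_le {A B F : Type*} [CStarAlgebra B] [NormedRing A]
    [NormedAlgebra ℂ A] [FunLike F B A] [AlgHomClass F ℂ B A] (e : F)
    (he : ∀ g : selfAdjoint B, ‖e (selfAdjoint.expUnitary g)‖ ≤ 1) (b : B) : ‖e b‖ ≤ ‖b‖ := by
  have key (y : B) (hy : ‖y‖ < 1) (n : ℕ) : ∀ u : unitary B, ‖e u‖ ≤ 1 →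
      ‖e ((u : B) + (n : ℂ) • y)‖ ≤ n + 1 := by
    induction n with
    | zero => intro u hu; simpa using hu
    | succ n ih =>
      intro u hu
      have hn : ‖(star u : unitary B) * y‖ < 1 := by
        rwa [CStarRing.norm_coe_unitary_mul]
      obtain ⟨g, k, hgk⟩ := exists_one_add_eq_expUnitary_mul hn
      set G := selfAdjoint.expUnitary g
      set K := selfAdjoint.expUnitary k
      have hK : ‖e (star K : unitary B)‖ ≤ 1 := by
        have := he (-k)
        have hc : Commute ((-k : selfAdjoint B) : B) (k : B) := by simp
        have h0 := hc.expUnitary_add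
        rw [neg_add_cancel, selfAdjoint.expUnitary_zero] at h0
        rwa [eq_inv_of_mul_eq_one_left h0.symm] at this
      have h1 : (u : B) + y = ((u * G * K : unitary B) : B) + (u * G * star K : unitary B) := by
        calc (u : B) + y = u * (1 + (star u : unitary B) * y) := by
              simp [mul_add, ← mul_assoc]
          _ = _ := by rw [hgk]; push_cast; noncomm_ring
      have hb (v : unitary B) (hv : ‖e v‖ ≤ 1) : ‖e (u * G * v : unitary B)‖ ≤ 1 := by
        push_cast
        rw [map_mul, map_mul]
        have := he g
        calc _ ≤ ‖e u‖ * ‖e G‖ * ‖e v‖ := norm_mul₃_le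
          _ ≤ 1 * 1 * 1 := by gcongr
          _ = 1 := by norm_num
      have h2 : (u : B) + ((n + 1 : ℕ) : ℂ) • y = ((u * G * star K : unitary B) : B) +
          ((u * G * K : unitary B) + (n : ℂ) • y) := by
        push_cast [add_smul, one_smul] at h1 ⊢
        rw [add_comm (_ • y), ← add_assoc, h1]
        abel
      rw [h2, map_add]
      have h3 := ih _ (hb K (he k))
      have h4 := hb _ hK
      have h5 := norm_add_le (e (u * G * star K : unitary B))
        (e (((u * G * K : unitary B) : B) + (n : ℂ) • y))
      push_cast at *
      linarith
  have key2 (y : B) (hy : ‖y‖ < 1) : ‖e y‖ ≤ 1 := by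
    have h1 : ‖e (1 : unitary B)‖ ≤ 1 := by simpa [selfAdjoint.expUnitary_zero] using he 0
    by_contra! hlt
    obtain ⟨n, hn⟩ := exists_nat_gt (2 / (‖e y‖ - 1))
    rw [div_lt_iff₀ (by linarith)] at hn
    have h2 := key y hy n 1 h1
    rw [map_add, map_smul] at h2
    have h3 := norm_sub_le (e (1 : unitary B) + (n : ℂ) • e y) (e (1 : unitary B))
    rw [add_sub_cancel_left, norm_smul] at h3
    simp only [Complex.norm_natCast] at h3
    linarith
  refine le_of_forall_pos_le_add fun ε hε ↦ ?_
  have hpos : 0 < ‖b‖ + ε := by positivity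
  have h := key2 (((‖b‖ + ε : ℝ) : ℂ)⁻¹ • b) (by
    rw [norm_smul, norm_inv, Complex.norm_real, Real.norm_of_nonneg hpos.le,
      inv_mul_lt_one₀ hpos]
    linarith)
  rwa [map_smul, norm_smul, norm_inv, Complex.norm_real, Real.norm_of_nonneg hpos.le,
      inv_mul_le_one₀ hpos] at h

/-- If `re ω(a) ≤ 0` for every state `ω`, then `1 - t a` is bounded below by one, for `t ≥ 0`. -/
theorem norm_le_norm_one_sub_smul_mul {A : Type*} [NormedRing A] [NormedAlgebra ℂ A]
    {a : A}
    (ha : ∀ ω : A →L[ℂ] ℂ, ‖ω‖ ≤ 1 → ω 1 = 1 → (ω a).re ≤ 0) {t : ℝ} (ht : 0 ≤ t) (x : A) :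
    ‖x‖ ≤ ‖(1 - (t : ℂ) • a) * x‖ := by
  obtain rfl | hx := eq_or_ne x 0
  · simp
  have hx' : 0 < ‖x‖ := norm_pos_iff.mpr hx
  obtain ⟨f, hf, hfx⟩ := exists_dual_vector ℂ x hx'.ne'
  let ω : A →L[ℂ] ℂ := (‖x‖ : ℂ)⁻¹ • (f.comp ((ContinuousLinearMap.mul ℂ A).flip x))
  have hω (y : A) : ω y = (‖x‖ : ℂ)⁻¹ * f (y * x) := by simp [ω]
  have h1 : ω 1 = 1 := by
    rw [hω, one_mul, hfx]
    exact inv_mul_cancel₀ (by exact_mod_cast hx'.ne')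
  have hn : ‖ω‖ ≤ 1 := by
    refine ω.opNorm_le_bound zero_le_one fun y ↦ ?_
    rw [hω, norm_mul, norm_inv, Complex.norm_real, norm_norm, inv_mul_le_iff₀ hx']
    calc ‖f (y * x)‖ ≤ ‖f‖ * ‖y * x‖ := f.le_opNorm _
      _ ≤ 1 * (‖y‖ * ‖x‖) := by rw [hf]; gcongr; exact norm_mul_le _ _
      _ = _ := by ring
  have h2 := ha ω hn h1
  have h3 : ω (1 - (t : ℂ) • a) = 1 - t * ω a := by simp [h1]
  have h4 : 1 ≤ ‖ω (1 - (t : ℂ) • a)‖ := by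
    refine le_trans ?_ (Complex.re_le_norm _)
    rw [h3]
    simp
    nlinarith
  rw [hω, norm_mul, norm_inv, Complex.norm_real, norm_norm, le_inv_mul_iff₀ hx', mul_one] at h4
  calc ‖x‖ ≤ _ := h4
    _ ≤ ‖f‖ * _ := f.le_opNorm _
    _ = _ := by rw [hf, one_mul]

/-- The exponential of a dissipative element is a contraction. -/
theorem norm_exp_le_one_of_re_le_zero {A : Type*} [NormedRing A] [NormedAlgebra ℂ A]
    [CompleteSpace A] (hone : ‖(1 : A)‖ = 1) {a : A}
    (ha : ∀ ω : A →L[ℂ] ℂ, ‖ω‖ ≤ 1 → ω 1 = 1 → (ω a).re ≤ 0) :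
    ‖NormedSpace.exp a‖ ≤ 1 := by
  let _ : NormedAlgebra ℚ A := NormedAlgebra.restrictScalars ℚ ℂ A
  have key : ∀ ε : ℝ, 0 < ε → (1 - ε) * ‖NormedSpace.exp a‖ ≤ 1 := by
    intro ε hε
    have hd : HasDerivAt (fun t : ℝ ↦ NormedSpace.exp (t • -a)) (-a) 0 := by
      simpa using hasDerivAt_exp_smul_const (𝕂 := ℝ) (-a) (0 : ℝ)
    have ho := (hasDerivAt_iff_isLittleO_nhds_zero.mp hd).bound hε
    have hlim : Filter.Tendsto (fun n : ℕ ↦ 1 / ((n : ℝ) + 1)) Filter.atTop (nhds 0) :=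
      tendsto_one_div_add_atTop_nhds_zero_nat
    have hev := hlim.eventually ho
    obtain ⟨n, hn, hnε⟩ := (hev.and (Filter.eventually_ge_atTop ⌈ε⌉₊)).exists
    set t : ℝ := 1 / ((n : ℝ) + 1) with ht
    have ht0 : 0 < t := by positivity
    have hεn : ε * t ≤ 1 := by
      rw [ht, mul_one_div, div_le_one (by positivity)]
      linarith [Nat.ceil_le.mp hnε]
    set E := NormedSpace.exp (t • -a) with hE
    have hEb : ‖E - (1 - (t : ℂ) • a)‖ ≤ ε * t := by
      have h1 : E - (1 - (t : ℂ) • a) =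
          NormedSpace.exp ((0 + t) • -a) - NormedSpace.exp ((0 : ℝ) • -a) - t • -a := by
        simp [hE]; abel
      rw [h1]
      simpa [abs_of_pos ht0] using hn
    have hstep (x : A) : (1 - ε * t) * ‖x‖ ≤ ‖E * x‖ := by
      have h1 := norm_le_norm_one_sub_smul_mul ha ht0.le x
      have h2 : (1 - (t : ℂ) • a) * x = E * x - (E - (1 - (t : ℂ) • a)) * x := by noncomm_ring
      have h3 := norm_sub_le (E * x) ((E - (1 - (t : ℂ) • a)) * x)
      have h4 := norm_mul_le (E - (1 - (t : ℂ) • a)) x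
      have h5 : ‖E - (1 - (t : ℂ) • a)‖ * ‖x‖ ≤ ε * t * ‖x‖ := by gcongr
      rw [← h2] at h3
      linarith
    have hpow (m : ℕ) (x : A) : (1 - ε * t) ^ m * ‖x‖ ≤ ‖E ^ m * x‖ := by
      induction m with
      | zero => simp
      | succ m ih =>
        rw [pow_succ', pow_succ', mul_assoc, mul_assoc]
        exact (mul_le_mul_of_nonneg_left ih (by linarith)).trans (hstep _)
    have h1 := hpow (n + 1) (NormedSpace.exp a)
    have h2 : E ^ (n + 1) = NormedSpace.exp (-a) := by
      rw [hE, ← NormedSpace.exp_nsmul, ← Nat.cast_smul_eq_nsmul ℝ, smul_smul, ht]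
      congr 1
      push_cast
      rw [mul_one_div_cancel (by positivity), one_smul]
    rw [h2, ← NormedSpace.exp_add_of_commute (Commute.neg_left (Commute.refl a)), neg_add_cancel,
      NormedSpace.exp_zero, hone] at h1
    have h3 := one_add_mul_le_pow (a := -(ε * t)) (by linarith) (n + 1)
    have h4 : 1 + ((n + 1 : ℕ) : ℝ) * -(ε * t) = 1 - ε := by
      rw [ht]; push_cast; field_simp; ring
    rw [h4, ← sub_eq_add_neg] at h3
    exact (mul_le_mul_of_nonneg_right h3 (norm_nonneg _)).trans h1
  refine le_of_forall_pos_le_add fun ε hε ↦ ?_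
  have h := key (ε / (‖NormedSpace.exp a‖ + 1)) (by positivity)
  have h2 : ε / (‖NormedSpace.exp a‖ + 1) * ‖NormedSpace.exp a‖ ≤ ε := by
    rw [div_mul_eq_mul_div, div_le_iff₀ (by positivity)]
    nlinarith [norm_nonneg (NormedSpace.exp a)]
  linarith

/-- The norm of an element is bounded by `e` times its numerical radius. -/
theorem norm_le_exp_one_mul_of_norm_apply_le {A : Type*} [NormedRing A] [NormedAlgebra ℂ A]
    [CompleteSpace A] (hone : ‖(1 : A)‖ = 1) {a : A} {m : ℝ} (hm : 0 ≤ m)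
    (ha : ∀ ω : A →L[ℂ] ℂ, ‖ω‖ ≤ 1 → ω 1 = 1 → ‖ω a‖ ≤ m) :
    ‖a‖ ≤ Real.exp 1 * m := by
  let _ : NormedAlgebra ℚ A := NormedAlgebra.restrictScalars ℚ ℂ A
  have main {r : ℝ} (hr : 0 < r) (hmr : m ≤ r) : ‖a‖ ≤ Real.exp 1 * r := by
    have hd (z : ℂ) : HasDerivAt (fun z : ℂ ↦ NormedSpace.exp (z • a))
        (NormedSpace.exp (z • a) * a) z := hasDerivAt_exp_smul_const a z
    have hdiff : Differentiable ℂ (fun z : ℂ ↦ NormedSpace.exp (z • a)) :=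
      fun z ↦ (hd z).differentiableAt
    have hbound : ∀ z ∈ Metric.sphere (0 : ℂ) r⁻¹, ‖NormedSpace.exp (z • a)‖ ≤ Real.exp 1 := by
      intro z hz
      have hz' : ‖z‖ = r⁻¹ := by simpa using hz
      have h1 : ‖NormedSpace.exp (z • a - algebraMap ℂ A 1)‖ ≤ 1 := by
        refine norm_exp_le_one_of_re_le_zero hone fun ω hω hω1 ↦ ?_
        have h2 : ‖z * ω a‖ ≤ 1 := by
          rw [norm_mul, hz', inv_mul_le_one₀ hr]
          exact (ha ω hω hω1).trans hmr
        have h3 := (Complex.re_le_norm (z * ω a)).trans h2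
        simpa [hω1] using h3
      have h2 : NormedSpace.exp (z • a) =
          NormedSpace.exp (z • a - algebraMap ℂ A 1) * NormedSpace.exp (algebraMap ℂ A 1) := by
        rw [← NormedSpace.exp_add_of_commute (Algebra.commutes 1 _).symm, sub_add_cancel]
      have h3 : ‖NormedSpace.exp (algebraMap ℂ A 1)‖ = Real.exp 1 := by
        rw [← NormedSpace.algebraMap_exp_comm, norm_algebraMap, hone, mul_one,
          ← Complex.exp_eq_exp_ℂ, Complex.norm_exp]
        simp
      rw [h2]
      refine (norm_mul_le _ _).trans ?_
      rw [h3]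
      exact mul_le_of_le_one_left (Real.exp_pos 1).le h1
    have h := Complex.norm_deriv_le_of_forall_mem_sphere_norm_le (inv_pos.mpr hr)
      hdiff.diffContOnCl hbound
    rw [(hd 0).deriv] at h
    simpa using h
  refine le_of_forall_pos_le_add fun ε hε ↦ ?_
  have h := main (r := m + ε / Real.exp 1) (by positivity) (by
    have : 0 < ε / Real.exp 1 := by positivity
    linarith)
  rwa [mul_add, mul_div_cancel₀ _ (Real.exp_pos 1).ne'] at h

/-- A complete C⋆-norm on a complex ⋆-algebra comes from a C⋆-algebra. -/
theorem RingNorm.exists_cstarAlgebra.{u} {A : Type u} [Ring A] [Algebra ℂ A] [StarRing A]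
    [StarModule ℂ A] (f : RingNorm A) (hsmul : ∀ (c : ℂ) (a : A), f (c • a) ≤ ‖c‖ * f a)
    (hstar : ∀ a, f a * f a ≤ f (star a * a))
    (hcomplete : ∀ u : ℕ → A, (∀ ε > 0, ∃ N, ∀ m ≥ N, ∀ n ≥ N, f (u m - u n) < ε) →
      ∃ a, ∀ ε > 0, ∃ N, ∀ n ≥ N, f (u n - a) < ε) :
    ∃ (B : Type u) (_ : CStarAlgebra B) (e : B ≃⋆ₐ[ℂ] A), ∀ b, ‖b‖ = f (e b) := by
  let i₁ : NormedRing A := f.toNormedRing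
  let i₂ : NormedAlgebra ℂ A := { ‹Algebra ℂ A› with norm_smul_le := hsmul }
  have i₃ : CompleteSpace A := by
    refine Metric.complete_of_cauchySeq_tendsto fun u hu ↦ ?_
    have hdist (x y : A) : dist x y = f (x - y) := by rw [dist_eq_norm]; rfl
    simp only [Metric.cauchySeq_iff, Metric.tendsto_atTop, hdist] at hu ⊢
    exact hcomplete u hu
  have i₄ : CStarRing A := ⟨fun {a} ↦ hstar a⟩
  let i₅ : CStarAlgebra A :=
    { i₁, i₂, i₃, i₄, ‹StarRing A›, ‹StarModule ℂ A› with }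
  exact ⟨A, i₅, StarAlgEquiv.refl ℂ A, fun _ ↦ rfl⟩

section PositiveFunctional

variable {A : Type*} [NormedRing A] [NormedAlgebra ℂ A] [StarRing A]

/-- The continuous positive functionals taking the value one at the identity. -/
def normalizedPositive (A : Type*) [NormedRing A] [NormedAlgebra ℂ A] [StarRing A] :
    Set (A →L[ℂ] ℂ) :=
  {φ | φ 1 = 1 ∧ ∀ a, 0 ≤ φ (star a * a)}

/-- The C⋆-seminorm `a ↦ sup φ (a⋆ a) ^ (1/2)`, over all continuous normalized positive `φ`. -/
noncomputable def gnsSeminorm (a : A) : ℝ :=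
  ⨆ φ : normalizedPositive A, √(φ.1 (star a * a)).re

theorem gnsSeminorm_nonneg (a : A) : 0 ≤ gnsSeminorm a :=
  Real.iSup_nonneg fun _ ↦ Real.sqrt_nonneg _

theorem gnsSeminorm_le {a : A} {r : ℝ} (hr : 0 ≤ r)
    (h : ∀ φ ∈ normalizedPositive A, √(φ (star a * a)).re ≤ r) : gnsSeminorm a ≤ r :=
  Real.iSup_le (fun φ ↦ h φ.1 φ.2) hr

variable [StarModule ℂ A]

/-- The semi-inner product `⟪a, b⟫ = φ (a⋆ b)` of a positive functional `φ`. -/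
noncomputable abbrev innerCoreOfPositive (φ : A →L[ℂ] ℂ) (hφ : ∀ a, 0 ≤ φ (star a * a)) :
    PreInnerProductSpace.Core ℂ A where
  inner a b := φ (star a * b)
  conj_inner_symm x y := by
    have h1 := (Complex.nonneg_iff.mp (hφ (x + y))).2
    have h2 := (Complex.nonneg_iff.mp (hφ (x + Complex.I • y))).2
    have hx := (Complex.nonneg_iff.mp (hφ x)).2
    have hy := (Complex.nonneg_iff.mp (hφ y)).2
    simp [add_mul, mul_add, ← hx, ← hy] at h1 h2
    apply Complex.ext
    · simp
      linarith
    · simp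
      linarith
  re_inner_nonneg x := (Complex.nonneg_iff.mp (hφ x)).1
  add_left x y z := by simp [add_mul]
  smul_left x y r := by simp

theorem map_star_of_positive {φ : A →L[ℂ] ℂ} (hφ : ∀ a, 0 ≤ φ (star a * a)) (a : A) :
    φ (star a) = star (φ a) := by
  have h : star (φ (star 1 * a)) = φ (star a * 1) :=
    (innerCoreOfPositive φ hφ).conj_inner_symm a 1
  rw [star_one, one_mul, mul_one] at h
  exact h.symm

theorem norm_map_star_mul_sq_le {φ : A →L[ℂ] ℂ} (hφ : ∀ a, 0 ≤ φ (star a * a)) (a b : A) :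
    ‖φ (star a * b)‖ ^ 2 ≤ (φ (star a * a)).re * (φ (star b * b)).re := by
  let c := innerCoreOfPositive φ hφ
  have h := InnerProductSpace.Core.inner_mul_inner_self_le (c := c) a b
  rw [InnerProductSpace.Core.norm_inner_symm b a, ← sq] at h
  exact h

theorem sqrt_map_star_add_mul_le {φ : A →L[ℂ] ℂ} (hφ : ∀ a, 0 ≤ φ (star a * a)) (a b : A) :
    √(φ (star (a + b) * (a + b))).re ≤ √(φ (star a * a)).re + √(φ (star b * b)).re := by
  have ha := (Complex.nonneg_iff.mp (hφ a)).1
  have hb := (Complex.nonneg_iff.mp (hφ b)).1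
  have h1 := norm_map_star_mul_sq_le hφ a b
  rw [Real.sqrt_le_left (by positivity), add_sq, Real.sq_sqrt ha, Real.sq_sqrt hb]
  have h2 : ‖φ (star a * b)‖ ≤ √(φ (star a * a)).re * √(φ (star b * b)).re := by
    rw [← Real.sqrt_mul ha]
    exact Real.le_sqrt_of_sq_le h1
  have h3 : φ (star b * a) = star (φ (star a * b)) := by
    rw [← map_star_of_positive hφ]; simp
  have h4 := Complex.re_le_norm (φ (star a * b))
  simp [add_mul, mul_add, h3]
  linarith

theorem norm_map_le_of_isSelfAdjoint {φ : A →L[ℂ] ℂ} (hφ : φ ∈ normalizedPositive A) {a : A}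
    (ha : IsSelfAdjoint a) : ‖φ a‖ ≤ ‖a‖ := by
  have hsq {b : A} (hb : IsSelfAdjoint b) : ‖φ b‖ ^ 2 ≤ ‖φ (b ^ 2)‖ := by
    have h := norm_map_star_mul_sq_le hφ.2 1 b
    rw [star_one, one_mul, one_mul, hφ.1, Complex.one_re, one_mul, hb.star_eq, ← sq b] at h
    exact h.trans (Complex.re_le_norm _)
  have hpow (n : ℕ) : ‖φ a‖ ^ 2 ^ n ≤ ‖φ (a ^ 2 ^ n)‖ := by
    induction n with
    | zero => simp
    | succ n ih =>
      rw [pow_succ 2 n, pow_mul, pow_mul]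
      exact (pow_le_pow_left₀ (by positivity) ih 2).trans (hsq (ha.pow _))
  have hbound (n : ℕ) : ‖φ a‖ ^ 2 ^ n ≤ ‖φ‖ * ‖a‖ ^ 2 ^ n :=
    (hpow n).trans <| (φ.le_opNorm _).trans <| by
      gcongr
      exact norm_pow_le' _ (by positivity)
  by_contra! hlt
  obtain h0 | h0 := (norm_nonneg a).eq_or_lt
  · have := hbound 0
    rw [← h0] at this hlt
    norm_num at this
    simp [this] at hlt
  · have h1 : 1 < ‖φ a‖ / ‖a‖ := (one_lt_div h0).mpr hlt
    obtain ⟨n, hn⟩ := pow_unbounded_of_one_lt ‖φ‖ h1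
    have h2 := hbound n
    rw [← div_le_iff₀ (by positivity), ← div_pow] at h2
    have h3 := pow_le_pow_right₀ h1.le (Nat.lt_two_pow_self (n := n)).le
    linarith

theorem sqrt_map_le {φ : A →L[ℂ] ℂ} (hφ : φ ∈ normalizedPositive A) (a : A) :
    √(φ (star a * a)).re ≤ √‖star a * a‖ :=
  Real.sqrt_le_sqrt <| (Complex.re_le_norm _).trans <|
    norm_map_le_of_isSelfAdjoint hφ (IsSelfAdjoint.star_mul_self a)

theorem sqrt_map_le_gnsSeminorm {φ : A →L[ℂ] ℂ} (hφ : φ ∈ normalizedPositive A) (a : A) :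
    √(φ (star a * a)).re ≤ gnsSeminorm a :=
  le_ciSup (f := fun φ : normalizedPositive A ↦ √(φ.1 (star a * a)).re)
    ⟨√‖star a * a‖, by rintro _ ⟨ψ, rfl⟩; exact sqrt_map_le ψ.2 a⟩ ⟨φ, hφ⟩

theorem re_map_le_gnsSeminorm_sq {φ : A →L[ℂ] ℂ} (hφ : φ ∈ normalizedPositive A) (a : A) :
    (φ (star a * a)).re ≤ gnsSeminorm a ^ 2 :=
  (Real.sqrt_le_left (gnsSeminorm_nonneg a)).mp (sqrt_map_le_gnsSeminorm hφ a)

theorem gnsSeminorm_sq_le_norm (a : A) : gnsSeminorm a ^ 2 ≤ ‖star a * a‖ := by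
  rw [← Real.le_sqrt (gnsSeminorm_nonneg a) (norm_nonneg _)]
  exact gnsSeminorm_le (Real.sqrt_nonneg _) fun φ hφ ↦ sqrt_map_le hφ a

theorem norm_map_le_gnsSeminorm {φ : A →L[ℂ] ℂ} (hφ : φ ∈ normalizedPositive A) (a : A) :
    ‖φ a‖ ≤ gnsSeminorm a := by
  have h := norm_map_star_mul_sq_le hφ.2 1 a
  simp only [star_one, one_mul, hφ.1, Complex.one_re] at h
  exact (Real.le_sqrt_of_sq_le h).trans (sqrt_map_le_gnsSeminorm hφ a)

theorem gnsSeminorm_add_le (a b : A) : gnsSeminorm (a + b) ≤ gnsSeminorm a + gnsSeminorm b :=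
  gnsSeminorm_le (add_nonneg (gnsSeminorm_nonneg a) (gnsSeminorm_nonneg b)) fun _ hφ ↦
    (sqrt_map_star_add_mul_le hφ.2 a b).trans <|
      add_le_add (sqrt_map_le_gnsSeminorm hφ a) (sqrt_map_le_gnsSeminorm hφ b)

theorem gnsSeminorm_smul_le (c : ℂ) (a : A) : gnsSeminorm (c • a) ≤ ‖c‖ * gnsSeminorm a := by
  refine gnsSeminorm_le (mul_nonneg (norm_nonneg c) (gnsSeminorm_nonneg a)) fun φ hφ ↦ ?_
  have h : (φ (star (c • a) * (c • a))).re = ‖c‖ ^ 2 * (φ (star a * a)).re := by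
    rw [star_smul, smul_mul_smul_comm, map_smul, Complex.star_def, ← Complex.normSq_eq_conj_mul_self,
      Complex.normSq_eq_norm_sq, smul_eq_mul, Complex.re_ofReal_mul]
  rw [h, Real.sqrt_mul (by positivity), Real.sqrt_sq (norm_nonneg c)]
  gcongr
  exact sqrt_map_le_gnsSeminorm hφ a

theorem gnsSeminorm_mul_le (a b : A) : gnsSeminorm (a * b) ≤ gnsSeminorm a * gnsSeminorm b := by
  refine gnsSeminorm_le (mul_nonneg (gnsSeminorm_nonneg a) (gnsSeminorm_nonneg b)) fun φ hφ ↦ ?_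
  have hb := Complex.nonneg_iff.mp (hφ.2 b)
  suffices h : (φ (star (a * b) * (a * b))).re ≤ gnsSeminorm a ^ 2 * (φ (star b * b)).re by
    rw [Real.sqrt_le_left (mul_nonneg (gnsSeminorm_nonneg a) (gnsSeminorm_nonneg b)), mul_pow]
    exact h.trans (by gcongr; exact re_map_le_gnsSeminorm_sq hφ b)
  have hassoc : star (a * b) * (a * b) = star b * (star a * a * b) := by
    simp [mul_assoc]
  obtain h0 | h0 := hb.1.eq_or_lt
  · have h1 := norm_map_star_mul_sq_le hφ.2 b (star a * a * b)
    rw [← h0, zero_mul] at h1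
    have h2 : ‖φ (star b * (star a * a * b))‖ = 0 := by
      nlinarith [norm_nonneg (φ (star b * (star a * a * b)))]
    rw [hassoc, norm_eq_zero.mp h2, ← h0]
    simp
  · set t := (φ (star b * b)).re
    have ht : φ (star b * b) = t := Complex.ext (by simp [t]) (by simpa using hb.2.symm)
    let ψ : A →L[ℂ] ℂ := (t : ℂ)⁻¹ •
      φ.comp ((ContinuousLinearMap.mul ℂ A (star b)).comp ((ContinuousLinearMap.mul ℂ A).flip b))
    have hψ (x : A) : ψ x = (t : ℂ)⁻¹ * φ (star b * (x * b)) := by simp [ψ]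
    have hψm : ψ ∈ normalizedPositive A := by
      refine ⟨?_, fun x ↦ ?_⟩
      · rw [hψ, one_mul, ht]
        exact inv_mul_cancel₀ (by exact_mod_cast h0.ne')
      · rw [hψ]
        refine mul_nonneg (by exact_mod_cast (inv_pos.mpr h0).le) ?_
        simpa [mul_assoc] using hφ.2 (x * b)
    have h1 := re_map_le_gnsSeminorm_sq hψm a
    rw [hψ, ← Complex.ofReal_inv, Complex.re_ofReal_mul, inv_mul_le_iff₀ h0] at h1
    rw [hassoc]
    linarith

theorem gnsSeminorm_sq_le (a : A) :
    gnsSeminorm a * gnsSeminorm a ≤ gnsSeminorm (star a * a) := by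
  rw [← sq, ← Real.le_sqrt (gnsSeminorm_nonneg a) (gnsSeminorm_nonneg _)]
  refine gnsSeminorm_le (Real.sqrt_nonneg _) fun φ hφ ↦ Real.sqrt_le_sqrt ?_
  exact (Complex.re_le_norm _).trans (norm_map_le_gnsSeminorm hφ _)

theorem gnsSeminorm_star (a : A) : gnsSeminorm (star a) = gnsSeminorm a := by
  have h (b : A) : gnsSeminorm b ≤ gnsSeminorm (star b) := by
    have h1 := (gnsSeminorm_sq_le b).trans (gnsSeminorm_mul_le (star b) b)
    obtain h0 | h0 := (gnsSeminorm_nonneg b).eq_or_lt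
    · rw [← h0]; exact gnsSeminorm_nonneg _
    · exact le_of_mul_le_mul_right h1 h0
  exact le_antisymm (by simpa using h (star a)) (h a)

end PositiveFunctional

/-- A continuous involution for which all states are positive is conjugate-linear. -/
theorem starModule_of_states {A : Type*} [NormedRing A] [NormedAlgebra ℂ A]
    [StarRing A] (hcont : Continuous (star : A → A))
    (h : ∀ ω : A →L[ℂ] ℂ, ‖ω‖ ≤ 1 → ω 1 = 1 → ∀ a : A, 0 ≤ ω (star a * a)) :
    StarModule ℂ A := by
  set j : A := star (Complex.I • 1) with hj
  have hjj : j * j = -1 := by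
    rw [hj, ← star_mul, smul_mul_smul_comm, Complex.I_mul_I]
    simp
  have hle := norm_le_norm_one_sub_smul_mul (a := -(j * (Complex.I • 1 : A))) (fun ω hω hω1 ↦ by
    rw [map_neg, Complex.neg_re, neg_nonpos]
    exact (Complex.nonneg_iff.mp (h ω hω hω1 _)).1) zero_le_one (Complex.I • j - 1)
  have h0 : (1 - ((1 : ℝ) : ℂ) • -(j * (Complex.I • 1 : A))) * (Complex.I • j - 1) = 0 := by
    simp only [Complex.ofReal_one, one_smul, mul_smul_comm, mul_one, sub_neg_eq_add]
    rw [add_mul, one_mul, mul_sub, mul_one, smul_mul_smul_comm, Complex.I_mul_I, hjj]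
    simp
  rw [h0, norm_zero] at hle
  have hIj : Complex.I • j = 1 := sub_eq_zero.mp (norm_le_zero_iff.mp hle)
  have hj' : j = -(Complex.I • (1 : A)) := by
    rw [← hIj, smul_smul, Complex.I_mul_I]; simp
  have hI (a : A) : star (Complex.I • a) = -(Complex.I • star a) := by
    have : Complex.I • a = (Complex.I • (1 : A)) * a := by simp
    rw [this, star_mul, ← hj, hj']
    simp
  have hr (r : ℝ) (a : A) : star ((r : ℂ) • a) = (r : ℂ) • star a := by
    simpa using map_real_smul (starAddEquiv : A ≃+ A) hcont r a
  refine ⟨fun c a ↦ ?_⟩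
  have hc : star c = c.re - c.im * Complex.I := by apply Complex.ext <;> simp
  rw [hc, sub_smul, mul_smul]
  nth_rw 1 [← Complex.re_add_im c]
  rw [add_smul, mul_smul, star_add, hr, hr, hI, smul_neg, sub_eq_add_neg]

/-- If every continuous linear functional attaining its norm at the identity is
positive, then the given norm and involution satisfy the C*-identity. -/
theorem stmt13 {A : Type*} [NormedRing A] [NormedAlgebra ℂ A] [CompleteSpace A]
    [StarRing A] (hcont : Continuous (star : A → A)) (hone : ‖(1 : A)‖ = 1)
    (h : ∀ ω : A →L[ℂ] ℂ, (‖ω‖ : ℂ) = ω 1 → ∀ a : A, 0 ≤ ω (star a * a)) :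
    ∀ a : A, ‖star a * a‖ = ‖a‖ ^ 2 := by
  have hstate : ∀ ω : A →L[ℂ] ℂ, ‖ω‖ ≤ 1 → ω 1 = 1 → ω ∈ normalizedPositive A := by
    refine fun ω hω hω1 ↦ ⟨hω1, h ω ?_⟩
    have h1 := ω.le_opNorm 1
    rw [hω1, hone, norm_one, mul_one] at h1
    rw [hω1, le_antisymm hω h1, Complex.ofReal_one]
  have hstar : StarModule ℂ A :=
    starModule_of_states hcont fun ω hω hω1 ↦ (hstate ω hω hω1).2
  have hlower (a : A) : ‖a‖ ≤ Real.exp 1 * gnsSeminorm a :=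
    norm_le_exp_one_mul_of_norm_apply_le hone (gnsSeminorm_nonneg a) fun ω hω hω1 ↦
      norm_map_le_gnsSeminorm (hstate ω hω hω1) a
  obtain ⟨C, hC0, hC⟩ : ∃ C : ℝ, 0 < C ∧ ∀ a : A, ‖star a‖ ≤ C * ‖a‖ := by
    let s : A →L[ℝ] A := (starAddEquiv : A ≃+ A).toAddMonoidHom.toRealLinearMap hcont
    exact s.bound
  have hupper (a : A) : gnsSeminorm a ≤ √C * ‖a‖ := by
    rw [← Real.sqrt_sq (norm_nonneg a), ← Real.sqrt_mul hC0.le,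
      Real.le_sqrt (gnsSeminorm_nonneg a) (by positivity)]
    calc _ ≤ ‖star a * a‖ := gnsSeminorm_sq_le_norm a
      _ ≤ ‖star a‖ * ‖a‖ := norm_mul_le _ _
      _ ≤ C * ‖a‖ * ‖a‖ := by gcongr; exact hC a
      _ = _ := by ring
  have hzero : gnsSeminorm (0 : A) = 0 := by
    simpa using gnsSeminorm_smul_le (0 : ℂ) (0 : A) |>.antisymm
      (by simpa using gnsSeminorm_nonneg (0 : A))
  let f : RingNorm A :=
    { toFun := gnsSeminorm
      map_zero' := hzero
      add_le' := gnsSeminorm_add_le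
      neg' := fun a ↦ by
        have hneg (b : A) : gnsSeminorm (-b) ≤ gnsSeminorm b := by
          simpa using gnsSeminorm_smul_le (-1 : ℂ) b
        exact (hneg a).antisymm (by simpa using hneg (-a))
      mul_le' := gnsSeminorm_mul_le
      eq_zero_of_map_eq_zero' := fun a ha ↦ norm_le_zero_iff.mp <| by
        have := hlower a
        rwa [show gnsSeminorm a = 0 from ha, mul_zero] at this }
  obtain ⟨B, _, e, he⟩ := f.exists_cstarAlgebra gnsSeminorm_smul_le gnsSeminorm_sq_le <| by
    intro u hu
    have hcau : CauchySeq u := by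
      refine Metric.cauchySeq_iff.mpr fun ε hε ↦ ?_
      obtain ⟨N, hN⟩ := hu (ε / Real.exp 1) (by positivity)
      refine ⟨N, fun m hm n hn ↦ ?_⟩
      rw [dist_eq_norm]
      refine (hlower _).trans_lt ?_
      rw [← lt_div_iff₀' (Real.exp_pos 1)]
      exact hN m hm n hn
    obtain ⟨a, ha⟩ := cauchySeq_tendsto_of_complete hcau
    refine ⟨a, fun ε hε ↦ ?_⟩
    obtain ⟨N, hN⟩ := Metric.tendsto_atTop.mp ha (ε / √C) (by positivity)
    refine ⟨N, fun n hn ↦ (hupper _).trans_lt ?_⟩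
    rw [← lt_div_iff₀' (by positivity), ← dist_eq_norm]
    exact hN n hn
  have hnorm (a : A) : ‖a‖ ≤ gnsSeminorm a := by
    have hec : Continuous e := AddMonoidHomClass.continuous_of_bound e (Real.exp 1) fun b ↦ by
      rw [he]; exact hlower _
    have hexp (g : selfAdjoint B) : ‖e (selfAdjoint.expUnitary g)‖ ≤ 1 := by
      let _ : NormedAlgebra ℚ B := NormedAlgebra.restrictScalars ℚ ℂ B
      let _ : NormedAlgebra ℚ A := NormedAlgebra.restrictScalars ℚ ℂ A
      rw [selfAdjoint.expUnitary_coe, NormedSpace.map_exp e hec]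
      refine norm_exp_le_one_of_re_le_zero hone fun ω hω hω1 ↦ ?_
      have h1 := map_star_of_positive (hstate ω hω hω1).2 (e g)
      rw [← map_star, g.2.star_eq] at h1
      have h2 : (ω (e g)).im = 0 := Complex.conj_eq_iff_im.mp h1.symm
      simp [h2]
    have h1 := CStarAlgebra.norm_map_le_of_norm_map_exp_le e hexp (e.symm a)
    rw [he, e.apply_symm_apply] at h1
    exact h1
  intro a
  have h1 : ‖star a * a‖ = gnsSeminorm a ^ 2 :=
    le_antisymm ((hnorm _).trans ((gnsSeminorm_mul_le _ _).trans_eq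
      (by rw [gnsSeminorm_star, sq]))) (gnsSeminorm_sq_le_norm a)
  have h2 : gnsSeminorm a ^ 2 ≤ gnsSeminorm a * ‖a‖ := by
    rw [← h1, ← gnsSeminorm_star a]
    exact (norm_mul_le _ _).trans (by gcongr; exact hnorm _)
  have h3 : gnsSeminorm a ≤ ‖a‖ := by
    nlinarith [gnsSeminorm_nonneg a, norm_nonneg a, hnorm a]
  rw [h1, le_antisymm h3 (hnorm a)]
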